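/- Let n ≥ 1, let λ > 0, let L > 0, let 0 < α ≤ 1/L, and let f : ℝ^n → ℝ be differentiable and L-smooth relative to h(x) = Σ_i x_i log x_i on S. Let x ∈ S and let x⁺ be a minimizer over the set {z ∈ S : supp(z) ⊆ supp(x)} of the function z ↦ ⟨∇f(x), z - x⟩ + (1/α) D(z, x) + λ‖z‖_0. Then f(x⁺) + λ‖x⁺‖_0 ≤ f(x) + λ‖x‖_0. -/

import Mathlib

open Finset Filter Topology

noncomputable def klS (a b : ℝ) : ℝ := if a = 0 then b else a * Real.log (a / b) - a + b

noncomputable def kl {n : ℕ} (x y : Fin n → ℝ) : ℝ := ∑ i, klS (x i) (y i)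

def probSimplex (n : ℕ) : Set (Fin n → ℝ) := {x | (∑ i, x i) = 1 ∧ ∀ i, 0 ≤ x i}

noncomputable def suppF {n : ℕ} (x : Fin n → ℝ) : Finset (Fin n) :=
  Finset.univ.filter (fun i => x i ≠ 0)

noncomputable def l0 {n : ℕ} (x : Fin n → ℝ) : ℕ := (suppF x).card

theorem klS_nonneg {a b : ℝ} (ha : 0 ≤ a) (hb : 0 ≤ b) (hab : a ≠ 0 → b ≠ 0) :
    0 ≤ klS a b := by
  unfold klS
  split_ifs with h
  · exact hb
  · have ha' : 0 < a := lt_of_le_of_ne ha (Ne.symm h)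
    have hb' : 0 < b := lt_of_le_of_ne hb (Ne.symm (hab h))
    have hlog := Real.one_sub_inv_le_log_of_pos (div_pos ha' hb')
    have hmul := mul_le_mul_of_nonneg_left hlog ha
    have heq : a * (1 - (a / b)⁻¹) = a - b := by field_simp
    linarith

theorem kl_nonneg_of_suppF_subset {n : ℕ} {x y : Fin n → ℝ} (hx : ∀ i, 0 ≤ x i)
    (hy : ∀ i, 0 ≤ y i) (hxy : suppF x ⊆ suppF y) : 0 ≤ kl x y :=
  Finset.sum_nonneg fun i _ => klS_nonneg (hx i) (hy i) fun hi => by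
    simpa [suppF] using hxy (show i ∈ suppF x by simpa [suppF] using hi)

theorem kl_self {n : ℕ} (x : Fin n → ℝ) : kl x x = 0 := by
  refine Finset.sum_eq_zero fun i _ => ?_
  unfold klS
  split_ifs with h
  · exact h
  · simp [div_self h]

/-- descent of the $\ell_0$-regularized objective after one Bregman step. -/
theorem stmt_6 (n : ℕ) (hn : 1 ≤ n) (lam L α : ℝ) (hlam : 0 < lam) (hL : 0 < L)
    (hα0 : 0 < α) (hαL : α ≤ 1 / L)
    (f : (Fin n → ℝ) → ℝ) (hf : Differentiable ℝ f)
    (hsmooth : ∀ z ∈ probSimplex n, ∀ w ∈ probSimplex n, suppF z ⊆ suppF w →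
      f z ≤ f w + fderiv ℝ f w (z - w) + L * kl z w)
    (x : Fin n → ℝ) (hx : x ∈ probSimplex n)
    (xplus : Fin n → ℝ) (hxp : xplus ∈ probSimplex n) (hxpsupp : suppF xplus ⊆ suppF x)
    (hmin : ∀ z ∈ probSimplex n, suppF z ⊆ suppF x →
      fderiv ℝ f x (xplus - x) + (1 / α) * kl xplus x + lam * (l0 xplus : ℝ) ≤
      fderiv ℝ f x (z - x) + (1 / α) * kl z x + lam * (l0 z : ℝ)) :
    f xplus + lam * (l0 xplus : ℝ) ≤ f x + lam * (l0 x : ℝ) := by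
  have hkl := kl_nonneg_of_suppF_subset hxp.2 hx.2 hxpsupp
  have hself := hmin x hx (Finset.Subset.refl _)
  rw [sub_self, map_zero, kl_self, mul_zero] at hself
  have hLα : L ≤ 1 / α := (le_one_div hα0 hL).mp hαL
  have hmul := mul_le_mul_of_nonneg_right hLα hkl
  have hdesc := hsmooth xplus hxp x hx hxpsupp
  linarith
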